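/- Fix an integer n ≥ 5. As N → ∞, the variance of the trace of the n-th power of the magnetic Hashimoto matrix satisfies Var(Tr[Y(Φ)^n]) = n N^n − 2 n² N^{n−1} + O(N^{n−2}). -/

import Mathlib

open MeasureTheory Matrix

noncomputable section

/-- The uniform probability measure on `[0, 2π)`. -/
def uniformPhase : Measure ℝ :=
  (ENNReal.ofReal (2 * Real.pi))⁻¹ • volume.restrict (Set.Ico 0 (2 * Real.pi))

/-- Product measure: the phases `ω μ ν` (used for `μ < ν`) are i.i.d. uniform on `[0, 2π)`. -/
def phaseMeasure (N : ℕ) : Measure (Fin N → Fin N → ℝ) :=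
  Measure.pi fun _ => Measure.pi fun _ => uniformPhase

/-- Antisymmetrized phases built from a raw sample: `φ ν μ = - φ μ ν`, `φ μ μ = 0`. -/
def phases (N : ℕ) (ω : Fin N → Fin N → ℝ) : Fin N → Fin N → ℝ :=
  fun μ ν => if μ < ν then ω μ ν else if ν < μ then - (ω ν μ) else 0

/-- The uni-modular matrix with phases `φ`: zero diagonal, `M μ ν = exp(i φ μ ν)` off diagonal. -/
def umeMatrix (N : ℕ) (φ : Fin N → Fin N → ℝ) : Matrix (Fin N) (Fin N) ℂ :=
  fun μ ν => if μ = ν then 0 else Complex.exp (Complex.I * (φ μ ν : ℂ))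


/-- A directed edge of the complete graph on `N` vertices: a pair `e = (j, i)` with `i ≠ j`;
its origin is `e.2` and its terminus is `e.1`. -/
abbrev DirEdge (N : ℕ) : Type := {e : Fin N × Fin N // e.1 ≠ e.2}

/-- The magnetic Hashimoto matrix of the complete graph on `N` vertices with phases `φ`:
`Y(Φ)_{e',e} = (δ_{o(e'),τ(e)} − δ_{e',ê}) · exp((i/2)(φ_e + φ_{e'}))`. -/
def hashimoto (N : ℕ) (φ : Fin N → Fin N → ℝ) :
    Matrix (DirEdge N) (DirEdge N) ℂ :=
  fun e' e =>
    (((if e'.1.2 = e.1.1 then 1 else 0) : ℂ) - ((if e'.1 = (e.1.2, e.1.1) then 1 else 0) : ℂ)) *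
      Complex.exp (Complex.I / 2 * ((φ e.1.1 e.1.2 : ℂ) + (φ e'.1.1 e'.1.2 : ℂ)))



/-! ### Phase integrals -/

lemma uniformPhase_isProb : IsProbabilityMeasure uniformPhase := by
  constructor
  have h : (0 : ℝ) < 2 * Real.pi := by positivity
  simp only [uniformPhase, Measure.smul_apply, Measure.restrict_apply_univ, Real.volume_Ico, sub_zero,
    smul_eq_mul]
  apply ENNReal.inv_mul_cancel
  · simpa using h
  · exact ENNReal.ofReal_ne_top

instance : IsProbabilityMeasure uniformPhase := uniformPhase_isProb

lemma integral_uniformPhase_exp (k : ℤ) :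
    ∫ x, Complex.exp (Complex.I * ((k : ℂ) * (x : ℂ))) ∂uniformPhase = if k = 0 then 1 else 0 := by
  split_ifs with h
  · subst h
    simp
  · have hpi : (0 : ℝ) ≤ 2 * Real.pi := by positivity
    rw [uniformPhase, integral_smul_measure]
    rw [← MeasureTheory.integral_Icc_eq_integral_Ico, MeasureTheory.integral_Icc_eq_integral_Ioc,
      ← intervalIntegral.integral_of_le hpi]
    have hc : Complex.I * (k : ℂ) ≠ 0 := by
      simp [Complex.I_ne_zero, h]
    have := integral_exp_mul_complex (a := 0) (b := 2 * Real.pi) hc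
    simp only [mul_assoc] at this
    rw [this]
    have h2 : Complex.exp (Complex.I * ((k : ℂ) * ((2 * Real.pi : ℝ) : ℂ))) = 1 := by
      rw [Complex.exp_eq_one_iff]
      exact ⟨k, by push_cast; ring⟩
    rw [h2]
    simp

lemma phase_sum (N : ℕ) (c : Fin N → Fin N → ℕ) (ω : Fin N → Fin N → ℝ) :
    ∑ a, ∑ b, (c a b : ℂ) * ((phases N ω a b : ℝ) : ℂ)
      = ∑ a, ∑ b, (((if a < b then (c a b : ℤ) - (c b a : ℤ) else 0 : ℤ)) : ℂ) * (ω a b : ℂ) := by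
  have h1 : ∀ a b, (c a b : ℂ) * ((phases N ω a b : ℝ) : ℂ)
      = (if a < b then (c a b : ℂ) * (ω a b : ℂ) else 0)
        - (if b < a then (c a b : ℂ) * (ω b a : ℂ) else 0) := by
    intro a b
    unfold phases
    rcases lt_trichotomy a b with h | h | h
    · simp [h, h.not_gt]
    · simp [h]
    · simp [h, h.not_gt]
  simp only [h1, Finset.sum_sub_distrib]
  rw [Finset.sum_comm (f := fun a b => if b < a then (c a b : ℂ) * (ω b a : ℂ) else 0)]
  rw [← Finset.sum_sub_distrib]
  refine Finset.sum_congr rfl fun a _ => ?_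
  rw [← Finset.sum_sub_distrib]
  refine Finset.sum_congr rfl fun b _ => ?_
  split_ifs
  · push_cast; ring
  · simp

lemma exp_phase_prod (N : ℕ) (c : Fin N → Fin N → ℕ) (ω : Fin N → Fin N → ℝ) :
    Complex.exp (Complex.I * ∑ a, ∑ b, (c a b : ℂ) * ((phases N ω a b : ℝ) : ℂ))
      = ∏ a, ∏ b, Complex.exp (Complex.I *
        ((((if a < b then (c a b : ℤ) - (c b a : ℤ) else 0 : ℤ)) : ℂ) * (ω a b : ℂ))) := by
  rw [phase_sum, Finset.mul_sum, Complex.exp_sum]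
  refine Finset.prod_congr rfl fun a _ => ?_
  rw [Finset.mul_sum, Complex.exp_sum]

open Classical in
lemma integral_phase (N : ℕ) (c : Fin N → Fin N → ℕ) :
    ∫ ω, Complex.exp (Complex.I * ∑ a, ∑ b, (c a b : ℂ) * ((phases N ω a b : ℝ) : ℂ)) ∂(phaseMeasure N)
      = if ∀ a b, c a b = c b a then 1 else 0 := by
  simp only [exp_phase_prod]
  unfold phaseMeasure
  have e1 := MeasureTheory.integral_fintype_prod_eq_prod (𝕜 := ℂ) (ι := Fin N) (E := fun _ => Fin N → ℝ)
    (μ := fun _ => Measure.pi fun _ => uniformPhase)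
    (fun a x => ∏ b, Complex.exp (Complex.I *
        ((((if a < b then (c a b : ℤ) - (c b a : ℤ) else 0 : ℤ)) : ℂ) * (x b : ℂ))))
  rw [e1]
  have e2 : ∀ a : Fin N, ∫ x : Fin N → ℝ, ∏ b, Complex.exp (Complex.I *
        ((((if a < b then (c a b : ℤ) - (c b a : ℤ) else 0 : ℤ)) : ℂ) * (x b : ℂ)))
          ∂(Measure.pi fun _ => uniformPhase)
      = ∏ b, if (if a < b then (c a b : ℤ) - (c b a : ℤ) else 0 : ℤ) = 0 then 1 else 0 := by
    intro a
    have := MeasureTheory.integral_fintype_prod_eq_prod (𝕜 := ℂ) (ι := Fin N) (E := fun _ => ℝ)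
      (μ := fun _ => uniformPhase)
      (fun b x => Complex.exp (Complex.I *
        ((((if a < b then (c a b : ℤ) - (c b a : ℤ) else 0 : ℤ)) : ℂ) * (x : ℂ))))
    rw [this]
    exact Finset.prod_congr rfl fun b _ => integral_uniformPhase_exp _
  simp only [e2]
  split_ifs with h
  · refine Finset.prod_eq_one fun a _ => Finset.prod_eq_one fun b _ => ?_
    rw [if_pos]
    split_ifs
    · rw [h a b]; ring
    · rfl
  · push Not at h
    obtain ⟨a, b, hab⟩ := h
    have key : ∀ a b : Fin N, a < b → c a b ≠ c b a →
        (∏ a, ∏ b, if (if a < b then (c a b : ℤ) - (c b a : ℤ) else 0 : ℤ) = 0 then (1 : ℂ) else 0) = 0 := by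
      intro a b hlt hne
      refine Finset.prod_eq_zero (Finset.mem_univ a) (Finset.prod_eq_zero (Finset.mem_univ b) ?_)
      rw [if_pos hlt, if_neg]
      omega
    rcases lt_trichotomy a b with h | h | h
    · exact key a b h hab
    · subst h; exact absurd rfl hab
    · exact key b a h hab.symm

lemma integrable_phase (N : ℕ) (c : Fin N → Fin N → ℕ) :
    Integrable (fun ω => Complex.exp (Complex.I * ∑ a, ∑ b, (c a b : ℂ) * ((phases N ω a b : ℝ) : ℂ)))
      (phaseMeasure N) := by
  simp only [exp_phase_prod]
  unfold phaseMeasure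
  refine Integrable.of_bound (C := 1) ?_ ?_
  · refine Measurable.aestronglyMeasurable ?_
    fun_prop
  · refine Filter.Eventually.of_forall fun ω => ?_
    rw [norm_prod]
    refine Finset.prod_le_one (fun _ _ => norm_nonneg _) fun a _ => ?_
    rw [norm_prod]
    refine Finset.prod_le_one (fun _ _ => norm_nonneg _) fun b _ => ?_
    rw [← Complex.ofReal_intCast, ← Complex.ofReal_mul, mul_comm, Complex.norm_exp_ofReal_mul_I]

/-! ### Expansion of the trace -/

lemma pow_apply_paths {E : Type*} [Fintype E] [DecidableEq E] (M : Matrix E E ℂ) (k : ℕ) (a b : E) :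
    (M ^ k) a b = ∑ p : Fin (k + 1) → E,
      if p 0 = a ∧ p (Fin.last k) = b then ∏ i : Fin k, M (p i.castSucc) (p i.succ) else 0 := by
  induction k generalizing a with
  | zero =>
    rw [← (Equiv.funUnique (Fin 1) E).symm.sum_comp]
    simp only [pow_zero, Matrix.one_apply, Finset.univ_eq_empty, Finset.prod_empty]
    rw [Finset.sum_eq_single a]
    · simp
    · intro c _ hc
      rw [if_neg]
      rintro ⟨h, _⟩
      exact hc h
    · simp
  | succ k ih =>
    rw [pow_succ', Matrix.mul_apply, ← (Fin.consEquiv (fun _ => E)).sum_comp, Fintype.sum_prod_type]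
    simp only [ih, Fin.consEquiv_apply, Fin.cons_zero]
    symm
    rw [Finset.sum_eq_single a]
    · simp only [Finset.mul_sum]
      rw [Finset.sum_comm]
      refine Finset.sum_congr rfl fun p _ => ?_
      rw [Finset.sum_eq_single (p 0)]
      · rw [← Fin.succ_last, Fin.prod_univ_succ]
        simp [← Fin.succ_castSucc]
      · intro c _ hc
        rw [if_neg (fun h => hc h.1.symm), mul_zero]
      · simp
    · intro c _ hc
      refine Finset.sum_eq_zero fun p _ => ?_
      rw [if_neg (fun h => hc h.1)]
    · simp

lemma trace_pow_cyc {E : Type*} [Fintype E] [DecidableEq E] (M : Matrix E E ℂ) (n : ℕ) [NeZero n] :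
    Matrix.trace (M ^ n) = ∑ p : ZMod n → E, ∏ i, M (p i) (p (i + 1)) := by
  obtain _ | k := n
  · exact absurd rfl (NeZero.ne 0)
  change _ = ∑ p : Fin (k + 1) → E, ∏ i : Fin (k + 1), M (p i) (p (i + 1))
  rw [pow_succ']
  simp only [Matrix.trace, Matrix.diag, Matrix.mul_apply]
  simp only [pow_apply_paths, Finset.mul_sum]
  rw [Finset.sum_congr rfl fun _ _ => Finset.sum_comm, Finset.sum_comm]
  refine Finset.sum_congr rfl fun p _ => ?_
  rw [Fin.prod_univ_castSucc]
  rw [Finset.sum_eq_single (p (Fin.last k))]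
  · rw [Finset.sum_eq_single (p 0)]
    · simp [mul_comm]
    · intro c _ hc
      rw [if_neg (fun h => hc h.1.symm), mul_zero]
    · simp
  · intro c _ hc
    refine Finset.sum_eq_zero fun d _ => ?_
    rw [if_neg (fun h => hc h.2.symm), mul_zero]
  · simp

/-- number of times the step `a → b` is used by the closed walk `w` -/
def stepCount {n : ℕ} [NeZero n] {α : Type*} [DecidableEq α] (w : ZMod n → α) (a b : α) : ℕ :=
  (Finset.univ.filter fun i => w i = a ∧ w (i + 1) = b).card

/-- cyclically non-backtracking closed walks -/
def NBW {n : ℕ} {α : Type*} (w : ZMod n → α) : Prop :=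
  ∀ i, w i ≠ w (i + 1) ∧ w i ≠ w (i + 2)

lemma sum_steps {n : ℕ} [NeZero n] {α : Type*} [DecidableEq α] [Fintype α] (w : ZMod n → α)
    (f : α → α → ℂ) : ∑ i, f (w i) (w (i + 1)) = ∑ a, ∑ b, (stepCount w a b : ℂ) * f a b := by
  have h : ∀ i, f (w i) (w (i + 1))
      = ∑ a, ∑ b, (if w i = a ∧ w (i + 1) = b then 1 else 0) * f a b := by
    intro i
    rw [Finset.sum_eq_single (w i), Finset.sum_eq_single (w (i + 1))]
    · simp
    · intro c _ hc
      rw [if_neg (fun h => hc h.2.symm), zero_mul]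
    · simp
    · intro c _ hc
      refine Finset.sum_eq_zero fun d _ => ?_
      rw [if_neg (fun h => hc h.1.symm), zero_mul]
    · simp
  simp only [h]
  rw [Finset.sum_comm]
  refine Finset.sum_congr rfl fun a _ => ?_
  rw [Finset.sum_comm]
  refine Finset.sum_congr rfl fun b _ => ?_
  rw [← Finset.sum_mul, stepCount, Finset.sum_boole]

lemma hashimoto_chain {n N : ℕ} [NeZero n] (φ : Fin N → Fin N → ℝ) (w : ZMod n → Fin N)
    (hw : ∀ i, w i ≠ w (i + 1)) (hw2 : ∀ i, w i ≠ w (i + 2)) :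
    ∏ i, hashimoto N φ ⟨(w i, w (i + 1)), hw i⟩ ⟨(w (i + 1), w (i + 1 + 1)), hw (i + 1)⟩
      = Complex.exp (Complex.I * ∑ a, ∑ b, (stepCount w a b : ℂ) * (φ a b : ℂ)) := by
  rw [← sum_steps w (fun a b => (φ a b : ℂ))]
  have h1 : ∀ i, hashimoto N φ ⟨(w i, w (i + 1)), hw i⟩ ⟨(w (i + 1), w (i + 1 + 1)), hw (i + 1)⟩
      = Complex.exp (Complex.I / 2 * ((φ (w (i + 1)) (w (i + 1 + 1)) : ℂ) + (φ (w i) (w (i + 1)) : ℂ))) := by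
    intro i
    have h2 : i + 1 + 1 = i + 2 := by ring
    simp only [hashimoto, Prod.mk.injEq, h2]
    rw [if_pos trivial, if_neg (fun h => hw2 i h.1)]
    simp
  simp only [h1]
  rw [← Complex.exp_sum, ← Finset.mul_sum, Finset.sum_add_distrib]
  have h3 := Equiv.sum_comp (Equiv.addRight (1 : ZMod n)) (fun i => (φ (w i) (w (i + 1)) : ℂ))
  simp only [Equiv.coe_addRight] at h3
  rw [h3]
  congr 1
  ring

open Classical in
lemma trace_hashimoto {n N : ℕ} [NeZero n] (φ : Fin N → Fin N → ℝ) :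
    Matrix.trace ((hashimoto N φ) ^ n) = ∑ w ∈ Finset.univ.filter (fun w : ZMod n → Fin N => NBW w),
      Complex.exp (Complex.I * ∑ a, ∑ b, (stepCount w a b : ℂ) * (φ a b : ℂ)) := by
  rw [trace_pow_cyc]
  symm
  refine Finset.sum_bij_ne_zero
    (fun w hw _ => fun i => ⟨(w i, w (i + 1)), ((Finset.mem_filter.1 hw).2 i).1⟩) ?_ ?_ ?_ ?_
  · intros; exact Finset.mem_univ _
  · intro w _ _ w' _ _ h
    funext i
    have := congrFun h i
    simp only [Subtype.mk.injEq, Prod.mk.injEq] at this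
    exact this.1
  · intro p _ hp
    have hp' : ∀ i, hashimoto N φ (p i) (p (i + 1)) ≠ 0 := by
      intro i hi
      exact hp (Finset.prod_eq_zero (Finset.mem_univ i) hi)
    have h1 : ∀ i, (p i).1.2 = (p (i + 1)).1.1 := by
      intro i
      by_contra hne
      apply hp' i
      unfold hashimoto
      rw [if_neg hne, if_neg]
      · simp
      · intro h
        apply hne
        rw [h]
    have h2 : ∀ i, (p i).1.1 ≠ (p (i + 1)).1.2 := by
      intro i heq
      apply hp' i
      unfold hashimoto
      rw [if_pos (h1 i), if_pos]
      · simp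
      · exact Prod.ext heq (h1 i)
    have hNB : NBW (fun i => (p i).1.1) := by
      intro i
      constructor
      · intro h
        exact (p i).2 (h.trans (h1 i).symm)
      · intro h
        apply h2 i
        rw [h1 (i + 1)]
        have : i + 1 + 1 = i + 2 := by ring
        rw [this]
        exact h
    refine ⟨fun i => (p i).1.1, by simpa using hNB, Complex.exp_ne_zero _, ?_⟩
    funext i
    apply Subtype.ext
    exact Prod.ext rfl (h1 i).symm
  · intro w hw _
    have hw' := (Finset.mem_filter.1 hw).2
    exact (hashimoto_chain φ w (fun i => (hw' i).1) (fun i => (hw' i).2)).symm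

/-! ### The structure of balanced pairs of walks -/

/-- the next time index on the same component -/
def nx {n : ℕ} (x : Bool × ZMod n) : Bool × ZMod n := (x.1, x.2 + 1)

lemma nx_inj {n : ℕ} {x y : Bool × ZMod n} (h : nx x = nx y) : x = y := by
  simp only [nx, Prod.mk.injEq, add_left_inj] at h
  exact Prod.ext h.1 h.2

lemma nx_surj {n : ℕ} (x : Bool × ZMod n) : ∃ y, nx y = x :=
  ⟨(x.1, x.2 - 1), by simp [nx]⟩

/-- set of visits of `p` -/
def vis {n : ℕ} [NeZero n] {α : Type*} [DecidableEq α] (u : Bool × ZMod n → α) (p : α) :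
    Finset (Bool × ZMod n) := Finset.univ.filter fun x => u x = p

/-- set of visits of `p` on the component `s` -/
def visC {n : ℕ} [NeZero n] {α : Type*} [DecidableEq α] (u : Bool × ZMod n → α) (s : Bool) (p : α) :
    Finset (Bool × ZMod n) := Finset.univ.filter fun x => u x = p ∧ x.1 = s

lemma mem_vis {n : ℕ} [NeZero n] {α : Type*} [DecidableEq α] {u : Bool × ZMod n → α} {p : α}
    {x : Bool × ZMod n} : x ∈ vis u p ↔ u x = p := by simp [vis]

lemma mem_visC {n : ℕ} [NeZero n] {α : Type*} [DecidableEq α] {u : Bool × ZMod n → α} {p : α}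
    {s : Bool} {x : Bool × ZMod n} : x ∈ visC u s p ↔ u x = p ∧ x.1 = s := by simp [visC]

lemma vis_card {n : ℕ} [NeZero n] {α : Type*} [DecidableEq α] (u : Bool × ZMod n → α) (s : Bool)
    (p : α) : (vis u p).card = (visC u s p).card + (visC u (!s) p).card := by
  rw [← Finset.card_filter_add_card_filter_not (s := vis u p) (fun x => x.1 = s)]
  congr 1
  · congr 1; ext x; simp [mem_vis, mem_visC]
  · congr 1; ext x; cases s <;> simp [mem_vis, mem_visC]

/-- A balanced pair of non-backtracking closed walks with many vertices. -/
structure Cfg {n : ℕ} [NeZero n] {α : Type*} [DecidableEq α] (u : Bool × ZMod n → α) : Prop where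
  nb1 : ∀ x, u x ≠ u (nx x)
  nb2 : ∀ x, u x ≠ u (nx (nx x))
  bal : ∀ a b, (Finset.univ.filter fun x => u x = a ∧ u (nx x) = b).card
      = (Finset.univ.filter fun x => u x = b ∧ u (nx x) = a).card
  large : n ≤ (Finset.univ.image u).card + 1

section cfg

variable {n : ℕ} [NeZero n] {α : Type*} [DecidableEq α] {u : Bool × ZMod n → α}

lemma Cfg.exists_mate (h : Cfg u) (x : Bool × ZMod n) :
    ∃ y, u y = u (nx x) ∧ u (nx y) = u x := by
  have h1 := h.bal (u x) (u (nx x))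
  have h2 : 0 < (Finset.univ.filter fun y => u y = u x ∧ u (nx y) = u (nx x)).card :=
    Finset.card_pos.2 ⟨x, by simp⟩
  rw [h1] at h2
  obtain ⟨y, hy⟩ := Finset.card_pos.1 h2
  exact ⟨y, by simpa using hy⟩

lemma Cfg.two_le (h : Cfg u) (x : Bool × ZMod n) : 2 ≤ (vis u (u x)).card := by
  obtain ⟨y, rfl⟩ := nx_surj x
  obtain ⟨z, hz1, hz2⟩ := h.exists_mate y
  refine Finset.one_lt_card.2 ⟨nx y, mem_vis.2 rfl, z, mem_vis.2 hz1, ?_⟩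
  rintro rfl
  exact h.nb2 y hz2.symm

lemma Cfg.sum_le (h : Cfg u) (S : Finset α) (hS : S ⊆ Finset.univ.image u) :
    ∑ p ∈ S, (vis u p).card ≤ 2 * S.card + 2 := by
  have h1 : (Finset.univ : Finset (Bool × ZMod n)).card
      = ∑ p ∈ Finset.univ.image u, (vis u p).card := Finset.card_eq_sum_card_image u Finset.univ
  rw [← Finset.sum_sdiff hS] at h1
  have h2 : (Finset.univ.image u \ S).card * 2 ≤ ∑ p ∈ Finset.univ.image u \ S, (vis u p).card := by
    rw [← smul_eq_mul]
    refine Finset.card_nsmul_le_sum _ _ _ fun p hp => ?_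
    obtain ⟨x, _, rfl⟩ := Finset.mem_image.1 (Finset.mem_sdiff.1 hp).1
    exact h.two_le x
  have h3 := Finset.card_sdiff_add_card_eq_card hS
  have h4 := h.large
  have h5 : (Finset.univ : Finset (Bool × ZMod n)).card = 2 * n := by
    rw [Finset.card_univ, Fintype.card_prod, ZMod.card, Fintype.card_bool]
  omega

lemma Cfg.mem_image_of_pos {p : α} (hp : 0 < (vis u p).card) :
    p ∈ Finset.univ.image u := by
  obtain ⟨x, hx⟩ := Finset.card_pos.1 hp
  exact Finset.mem_image.2 ⟨x, Finset.mem_univ _, mem_vis.1 hx⟩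

lemma Cfg.le4 (h : Cfg u) (p : α) : (vis u p).card ≤ 4 := by
  by_contra hc
  have := h.sum_le {p} (by
    rw [Finset.singleton_subset_iff]
    exact Cfg.mem_image_of_pos (by omega))
  simp at this
  omega

lemma Cfg.le6 (h : Cfg u) {p q : α} (hpq : p ≠ q) (hp : 0 < (vis u p).card)
    (hq : 0 < (vis u q).card) : (vis u p).card + (vis u q).card ≤ 6 := by
  have := h.sum_le {p, q} (by
    intro x hx
    simp only [Finset.mem_insert, Finset.mem_singleton] at hx
    rcases hx with rfl | rfl
    · exact Cfg.mem_image_of_pos hp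
    · exact Cfg.mem_image_of_pos hq)
  rw [Finset.sum_pair hpq, Finset.card_pair hpq] at this
  omega

lemma Cfg.le8 (h : Cfg u) {p q r : α} (hpq : p ≠ q) (hpr : p ≠ r) (hqr : q ≠ r)
    (hp : 0 < (vis u p).card) (hq : 0 < (vis u q).card) (hr : 0 < (vis u r).card) :
    (vis u p).card + (vis u q).card + (vis u r).card ≤ 8 := by
  have := h.sum_le {p, q, r} (by
    intro x hx
    simp only [Finset.mem_insert, Finset.mem_singleton] at hx
    rcases hx with rfl | rfl | rfl
    · exact Cfg.mem_image_of_pos hp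
    · exact Cfg.mem_image_of_pos hq
    · exact Cfg.mem_image_of_pos hr)
  rw [Finset.sum_insert (by simp [hpq, hpr]), Finset.sum_pair hqr,
    Finset.card_insert_of_notMem (by simp [hpq, hpr]), Finset.card_pair hqr] at this
  omega

lemma four_le {β : Type*} [DecidableEq β] {S : Finset β} {a b c d : β} (ha : a ∈ S) (hb : b ∈ S)
    (hc : c ∈ S) (hd : d ∈ S) (hab : a ≠ b) (hac : a ≠ c) (had : a ≠ d) (hbc : b ≠ c) (hbd : b ≠ d)
    (hcd : c ≠ d) : 4 ≤ S.card := by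
  have h1 : ({a, b, c, d} : Finset β) ⊆ S := by
    intro x hx
    simp only [Finset.mem_insert, Finset.mem_singleton] at hx
    rcases hx with rfl | rfl | rfl | rfl <;> assumption
  have h2 : ({a, b, c, d} : Finset β).card = 4 := by
    rw [Finset.card_insert_of_notMem (by simp [hab, hac, had]),
      Finset.card_insert_of_notMem (by simp [hbc, hbd]), Finset.card_pair hcd]
  exact h2 ▸ Finset.card_le_card h1

lemma Cfg.step_inj (h : Cfg u) {x y : Bool × ZMod n} (h1 : u x = u y) (h2 : u (nx x) = u (nx y)) :
    x = y := by
  by_contra hxy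
  have h3 : 1 < (Finset.univ.filter fun z => u z = u x ∧ u (nx z) = u (nx x)).card :=
    Finset.one_lt_card.2 ⟨x, by simp, y, by simp [h1, h2], hxy⟩
  rw [h.bal] at h3
  obtain ⟨z, hz, t, ht, hzt⟩ := Finset.one_lt_card.1 h3
  simp only [Finset.mem_filter, Finset.mem_univ, true_and] at hz ht
  have c1 : 4 ≤ (vis u (u x)).card := by
    refine four_le (a := x) (b := y) (c := nx z) (d := nx t) (mem_vis.2 rfl) (mem_vis.2 h1.symm)
      (mem_vis.2 hz.2) (mem_vis.2 ht.2) hxy ?_ ?_ ?_ ?_ (fun e => hzt (nx_inj e))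
    · rintro rfl; exact h.nb2 z hz.1
    · rintro rfl; exact h.nb2 t ht.1
    · rintro rfl; exact h.nb2 z (hz.1.trans h2)
    · rintro rfl; exact h.nb2 t (ht.1.trans h2)
  have c2 : 4 ≤ (vis u (u (nx x))).card := by
    refine four_le (a := nx x) (b := nx y) (c := z) (d := t) (mem_vis.2 rfl) (mem_vis.2 h2.symm)
      (mem_vis.2 hz.1) (mem_vis.2 ht.1) (fun e => hxy (nx_inj e)) ?_ ?_ ?_ ?_ hzt
    · rintro rfl; exact h.nb2 x hz.2.symm
    · rintro rfl; exact h.nb2 x ht.2.symm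
    · rintro rfl; exact h.nb2 y (h1.symm.trans hz.2.symm)
    · rintro rfl; exact h.nb2 y (h1.symm.trans ht.2.symm)
  have := h.le6 (h.nb1 x) (by omega) (by omega)
  omega

/-- A configuration together with the reversal map on steps. -/
structure Mate (u : Bool × ZMod n → α) (σ : Bool × ZMod n → Bool × ZMod n) : Prop extends Cfg u where
  m1 : ∀ x, u (σ x) = u (nx x)
  m2 : ∀ x, u (nx (σ x)) = u x

lemma Cfg.exists_Mate (h : Cfg u) : ∃ σ, Mate u σ := by
  choose σ h1 h2 using h.exists_mate
  exact ⟨σ, ⟨h, h1, h2⟩⟩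

variable {σ : Bool × ZMod n → Bool × ZMod n}

lemma Mate.invol (h : Mate u σ) (x) : σ (σ x) = x :=
  h.step_inj ((h.m1 _).trans (h.m2 _)) ((h.m2 _).trans (h.m1 _))

lemma Mate.inj (h : Mate u σ) {x y} (e : σ x = σ y) : x = y := by
  rw [← h.invol x, e, h.invol]

lemma Mate.ne_self (h : Mate u σ) (x) : σ x ≠ x := by
  intro e
  apply h.nb1 x
  rw [← h.m1 x, e]

lemma Mate.ne_nx (h : Mate u σ) (x) : σ x ≠ nx x := by
  intro e
  apply h.nb2 x
  rw [← h.m2 x, e]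

lemma Mate.nx_ne (h : Mate u σ) (x) : nx (σ x) ≠ x := by
  intro e
  apply h.ne_nx (σ x)
  rw [h.invol, e]

lemma Mate.visit_in (h : Mate u σ) (x) : σ x ∈ vis u (u (nx x)) := mem_vis.2 (h.m1 x)
lemma Mate.visit_out (h : Mate u σ) (x) : nx (σ x) ∈ vis u (u x) := mem_vis.2 (h.m2 x)

/-- transitions between cross and non-cross steps -/
lemma exists_trans {P : Bool × ZMod n → Prop} {s : Bool} (h1 : ∃ x, x.1 = s ∧ P x)
    (h2 : ∃ x, x.1 = s ∧ ¬ P x) : ∃ x, x.1 = s ∧ P x ∧ ¬ P (nx x) := by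
  by_contra hc
  push Not at hc
  obtain ⟨⟨s, i⟩, rfl, hx⟩ := h1
  obtain ⟨⟨t, j⟩, rfl, hy⟩ := h2
  have : ∀ k : ℕ, P (t, i + k) := by
    intro k
    induction k with
    | zero => simpa using hx
    | succ k ih =>
      have := hc (t, i + k) rfl ih
      simpa [nx, add_assoc] using this
  apply hy
  have h3 := this (j - i).val
  simpa using h3

/-- vertices of transitions from cross to non-cross -/
lemma Mate.trans_counts (h : Mate u σ) {s : Bool} {x : Bool × ZMod n} (hs : x.1 = s)
    (h1 : (σ x).1 ≠ x.1) (h2 : (σ (nx x)).1 = (nx x).1) :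
    2 ≤ (visC u s (u (nx x))).card ∧ 1 ≤ (visC u (!s) (u (nx x))).card := by
  constructor
  · refine Finset.one_lt_card.2 ⟨nx x, mem_visC.2 ⟨rfl, hs⟩, nx (σ (nx x)),
      mem_visC.2 ⟨h.m2 _, h2.trans hs⟩, (h.nx_ne _).symm⟩
  · refine Finset.card_pos.2 ⟨σ x, mem_visC.2 ⟨h.m1 _, ?_⟩⟩
    rw [hs] at h1
    revert h1
    cases (σ x).1 <;> cases s <;> simp

/-- vertices of transitions from non-cross to cross -/
lemma Mate.trans_counts' (h : Mate u σ) {s : Bool} {x : Bool × ZMod n} (hs : x.1 = s)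
    (h1 : (σ x).1 = x.1) (h2 : (σ (nx x)).1 ≠ (nx x).1) :
    2 ≤ (visC u s (u (nx x))).card ∧ 1 ≤ (visC u (!s) (u (nx x))).card := by
  constructor
  · refine Finset.one_lt_card.2 ⟨nx x, mem_visC.2 ⟨rfl, hs⟩, σ x,
      mem_visC.2 ⟨h.m1 _, h1.trans hs⟩, (h.ne_nx _).symm⟩
  · refine Finset.card_pos.2 ⟨nx (σ (nx x)), mem_visC.2 ⟨h.m2 _, ?_⟩⟩
    simp only [nx] at h2 ⊢
    rw [hs] at h2
    rw [hs]
    revert h2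
    cases (σ (s, x.2 + 1)).1 <;> cases s <;> simp

/-- reversed runs -/
lemma run_reverse {j : Bool × ZMod n} {m : ℕ}
    (hrun : ∀ k : ℕ, k + 1 < m → nx (σ (j.1, j.2 + (k + 1 : ℕ))) = σ (j.1, j.2 + (k : ℕ))) :
    ∀ k : ℕ, k < m → σ (j.1, j.2 + (k : ℕ)) = ((σ j).1, (σ j).2 - (k : ℕ)) := by
  intro k
  induction k with
  | zero => intro _; simp
  | succ k ih =>
    intro hk
    have h1 := hrun k hk
    rw [ih (by omega)] at h1
    simp only [nx, Prod.mk.injEq] at h1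
    refine Prod.ext h1.1 ?_
    push_cast
    push_cast at h1
    linear_combination h1.2

lemma Mate.all_cross_aux (h : Mate u σ) {s : Bool}
    (hb : ∃ x, x.1 = s ∧ (σ x).1 ≠ x.1 ∧ ¬ (σ (nx x)).1 ≠ (nx x).1)
    (hb' : ∃ x, x.1 = (!s) ∧ (σ x).1 ≠ x.1 ∧ ¬ (σ (nx x)).1 ≠ (nx x).1) : False := by
  obtain ⟨b, hbs, hb1, hb2⟩ := hb
  obtain ⟨b', hbs', hb1', hb2'⟩ := hb'
  rw [not_not] at hb2 hb2'
  obtain ⟨c1, c2⟩ := h.trans_counts hbs hb1 hb2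
  obtain ⟨c1', c2'⟩ := h.trans_counts hbs' hb1' hb2'
  rw [Bool.not_not] at c2'
  set j := nx b with hj
  set p := u j with hp
  set p' := u (nx b') with hp'
  have hjs : j.1 = s := hbs
  have e1 := vis_card u s p
  have e2 := vis_card u s p'
  -- no vertex is visited three times on the component `s`
  have hi : ∀ q, (visC u s q).card ≤ 2 := by
    intro q
    by_contra hq
    have e3 := vis_card u s q
    have l4 := h.le4
    by_cases hqp : q = p
    · by_cases hpp : p = p'
      · rw [← hpp] at e2 c1' c2'
        rw [hqp] at e3 hq
        have := l4 p
        omega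
      · have := h.le6 hpp (by omega) (by omega)
        rw [hqp] at e3 hq
        omega
    · have a1 := h.le6 hqp (by omega) (by omega)
      by_cases hpp : p = p'
      · rw [← hpp] at e2 c1' c2'
        omega
      · by_cases hqp' : q = p'
        · rw [← hqp'] at e2 c1' c2'
          omega
        · have := h.le8 hqp hqp' hpp (by omega) (by omega) (by omega)
          omega
  have hii : ∀ q, 2 ≤ (visC u s q).card → 1 ≤ (visC u (!s) q).card → q = p := by
    intro q hq1 hq2
    by_contra hqp
    have e3 := vis_card u s q
    have a1 := h.le6 hqp (by omega) (by omega)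
    by_cases hpp : p = p'
    · rw [← hpp] at e2 c1' c2'
      omega
    · by_cases hqp' : q = p'
      · rw [← hqp'] at e2 c1' c2'
        omega
      · have := h.le8 hqp hqp' hpp (by omega) (by omega) (by omega)
        omega
  -- the length of the run
  have hex : ∃ m : ℕ, (σ (s, j.2 + (m : ℕ))).1 ≠ s := by
    refine ⟨(b.2 - j.2).val, ?_⟩
    have : (s, j.2 + (((b.2 - j.2).val : ℕ) : ZMod n)) = b := by
      refine Prod.ext hbs.symm ?_
      simp
    rw [this, ← hbs]
    exact hb1
  classical
  obtain ⟨m, hm, hmin⟩ : ∃ m : ℕ, (σ (s, j.2 + (m : ℕ))).1 ≠ s ∧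
      ∀ k < m, (σ (s, j.2 + (k : ℕ))).1 = s := by
    refine ⟨Nat.find hex, Nat.find_spec hex, fun k hk => ?_⟩
    have := Nat.find_min hex hk
    rwa [not_not] at this
  have hj' : j = (s, j.2) := Prod.ext hjs rfl
  have hm0 : m ≠ 0 := by
    rintro rfl
    apply hm
    rw [Nat.cast_zero, add_zero, ← hj', hb2, hjs]
  have hnx : ∀ k : ℕ, nx (s, j.2 + (k : ZMod n)) = (s, j.2 + ((k + 1 : ℕ) : ZMod n)) := by
    intro k
    simp [nx, add_assoc]
  have hrev := run_reverse (σ := σ) (j := j) (m := m) (by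
    rw [hjs]
    intro k hk
    by_contra hbr
    have h3 := hi (u (nx (s, j.2 + (k : ZMod n))))
    have : 2 < (visC u s (u (nx (s, j.2 + (k : ZMod n))))).card := by
      refine Finset.two_lt_card.2 ⟨_, mem_visC.2 ⟨rfl, rfl⟩, σ (s, j.2 + (k : ZMod n)),
        mem_visC.2 ⟨h.m1 _, hmin k (by omega)⟩, nx (σ (s, j.2 + ((k + 1 : ℕ) : ZMod n))),
        mem_visC.2 ⟨?_, hmin (k + 1) hk⟩, ?_, ?_, ?_⟩
      · rw [h.m2, hnx]
      · exact (h.ne_nx _).symm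
      · rw [hnx]
        exact (h.nx_ne _).symm
      · exact fun e => hbr e.symm
    omega)
  rw [hjs] at hrev
  -- the end of the run
  obtain ⟨t, rfl⟩ : ∃ t, m = t + 1 := ⟨m - 1, by omega⟩
  have ht := hmin t (by omega)
  have hq := h.trans_counts' (x := (s, j.2 + (t : ZMod n))) (s := s) rfl ht (by rw [hnx]; exact hm)
  have hqp := hii _ hq.1 hq.2
  rw [hnx] at hqp
  have hend : (s, j.2 + ((t + 1 : ℕ) : ZMod n)) = nx (σ j) := by
    by_contra hne
    have : 2 < (visC u s p).card := by
      refine Finset.two_lt_card.2 ⟨(s, j.2 + ((t + 1 : ℕ) : ZMod n)), mem_visC.2 ⟨hqp, rfl⟩,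
        nx (σ j), mem_visC.2 ⟨h.m2 _, hb2.trans hjs⟩, j, mem_visC.2 ⟨rfl, hjs⟩, hne, ?_, h.nx_ne _⟩
      intro e
      rw [e, hb2] at hm
      exact hm hjs
    have := hi p
    omega
  simp only [nx, Prod.mk.injEq] at hend
  have hs2 : (σ j).2 = j.2 + (t : ZMod n) := by
    have := hend.2
    push_cast at this
    linear_combination -this
  rcases Nat.even_or_odd' t with ⟨r, hr | hr⟩
  · have h5 := hrev r (by omega)
    apply h.ne_self (s, j.2 + (r : ZMod n))
    rw [h5]
    refine Prod.ext hend.1.symm ?_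
    rw [hs2, hr]
    push_cast
    ring
  · have h5 := hrev r (by omega)
    apply h.ne_nx (s, j.2 + (r : ZMod n))
    rw [h5]
    refine Prod.ext hend.1.symm ?_
    simp only [nx]
    rw [hs2, hr]
    push_cast
    ring

lemma Mate.all_cross (h : Mate u σ) (hx : ∃ x, (σ x).1 ≠ x.1) : ∀ x, (σ x).1 ≠ x.1 := by
  by_contra hc
  push Not at hc
  have hcross : ∀ s : Bool, ∃ x, x.1 = s ∧ (σ x).1 ≠ x.1 := by
    obtain ⟨x, hx⟩ := hx
    intro s
    by_cases hs : x.1 = s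
    · exact ⟨x, hs, hx⟩
    · refine ⟨σ x, ?_, ?_⟩
      · revert hs hx
        cases x.1 <;> cases s <;> cases (σ x).1 <;> simp
      · rw [h.invol]; exact hx.symm
  have key : ∀ s : Bool, (∀ x, x.1 = s → (σ x).1 ≠ x.1) → ∀ x, x.1 = (!s) → (σ x).1 ≠ x.1 := by
    intro s hs
    have hinj : Function.Injective (fun i : ZMod n => (σ (s, i)).2) := by
      intro i i' hii
      have e1 := hs (s, i) rfl
      have e2 := hs (s, i') rfl
      have : σ (s, i) = σ (s, i') := by
        refine Prod.ext ?_ hii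
        revert e1 e2
        cases (σ (s, i)).1 <;> cases (σ (s, i')).1 <;> cases s <;> simp
      simpa using h.inj this
    have hsurj := Finite.surjective_of_injective hinj
    intro x hxs
    obtain ⟨i, hi⟩ := hsurj x.2
    have e1 := hs (s, i) rfl
    have : σ (s, i) = x := by
      refine Prod.ext ?_ hi
      rw [hxs]
      revert e1
      cases (σ (s, i)).1 <;> cases s <;> simp
    rw [← this, h.invol]
    exact e1.symm
  have hnc : ∀ s : Bool, ∃ x, x.1 = s ∧ ¬ (σ x).1 ≠ x.1 := by
    intro s
    by_contra hs
    push Not at hs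
    have h1 := key s hs
    obtain ⟨x, hx⟩ := hc
    by_cases hxs : x.1 = s
    · exact hs x hxs hx
    · exact h1 x (by revert hxs; cases x.1 <;> cases s <;> simp) hx
  exact h.all_cross_aux (s := true) (exists_trans (P := fun x => (σ x).1 ≠ x.1) (hcross _) (hnc _))
    (exists_trans (P := fun x => (σ x).1 ≠ x.1) (hcross _) (hnc _))

lemma Mate.no_break (h : Mate u σ) (hc : ∀ x, (σ x).1 ≠ x.1) (x : Bool × ZMod n) :
    nx (σ (nx x)) = σ x := by
  by_contra hbr
  obtain ⟨s, i⟩ := x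
  have hc' : ∀ y, (σ y).1 = !y.1 := by
    intro y
    have := hc y
    revert this
    cases (σ y).1 <;> cases y.1 <;> simp
  set j := nx (s, i) with hj
  set p := u j with hp
  have hjs : j.1 = s := rfl
  -- the four visits of `p`
  set j2 := nx (σ (nx (σ j))) with hj2
  have v1 : u (σ (s, i)) = p := h.m1 _
  have v2 : u (nx (σ j)) = p := h.m2 _
  have v3 : u j2 = p := (h.m2 _).trans v2
  have k1 : (σ (s, i)).1 = !s := hc' _
  have k2 : (nx (σ j)).1 = !s := hc' _
  have k3 : j2.1 = s := by
    have : j2.1 = !(nx (σ j)).1 := hc' _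
    rw [this, k2, Bool.not_not]
  have hjj : j ≠ j2 := by
    intro e
    have e1 := nx_inj (e : nx (s, i) = nx (σ (nx (σ j))))
    apply hbr
    rw [e1, h.invol]
  have w1 : 2 ≤ (visC u s p).card :=
    Finset.one_lt_card.2 ⟨j, mem_visC.2 ⟨rfl, hjs⟩, j2, mem_visC.2 ⟨v3, k3⟩, hjj⟩
  have w2 : 2 ≤ (visC u (!s) p).card :=
    Finset.one_lt_card.2 ⟨_, mem_visC.2 ⟨v2, k2⟩, _, mem_visC.2 ⟨v1, k1⟩, hbr⟩
  have w3 := vis_card u s p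
  have w4 := h.le4 p
  have hother : ∀ y, u (nx y) ≠ p → nx (σ (nx y)) = σ y := by
    intro y hy
    by_contra hbr'
    have : 2 < (vis u (u (nx y))).card :=
      Finset.two_lt_card.2 ⟨nx y, mem_vis.2 rfl, σ y, h.visit_in y, nx (σ (nx y)), h.visit_out (nx y),
        (h.ne_nx _).symm, (h.nx_ne _).symm, fun e => hbr' e.symm⟩
    have := h.le6 hy (by omega) (by omega)
    omega
  have hex : ∃ m : ℕ, u (s, j.2 + ((m + 1 : ℕ) : ZMod n)) = p := by
    refine ⟨n - 1, ?_⟩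
    have h1 : n - 1 + 1 = n := Nat.succ_pred_eq_of_ne_zero (NeZero.ne n)
    rw [h1]
    simp [hp, hj, nx]
  classical
  obtain ⟨m, hm, hmin⟩ : ∃ m : ℕ, u (s, j.2 + ((m + 1 : ℕ) : ZMod n)) = p ∧
      ∀ k < m, u (s, j.2 + ((k + 1 : ℕ) : ZMod n)) ≠ p :=
    ⟨Nat.find hex, Nat.find_spec hex, fun k hk => Nat.find_min hex hk⟩
  have hnx : ∀ k : ℕ, nx (s, j.2 + (k : ZMod n)) = (s, j.2 + ((k + 1 : ℕ) : ZMod n)) := by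
    intro k
    simp [nx, add_assoc]
  have hrev := run_reverse (σ := σ) (j := j) (m := m + 1) (by
    rw [hjs]
    intro k hk
    rw [← hnx]
    apply hother
    rw [hnx]
    exact hmin k (by omega))
  rw [hjs] at hrev
  have h5 := hrev m (by omega)
  have v4 : u (σ (s, j.2 + (m : ZMod n))) = p := by rw [h.m1, hnx, hm]
  have k4 : (σ (s, j.2 + (m : ZMod n))).1 = !s := hc' _
  have hcase : σ (s, j.2 + (m : ZMod n)) = σ (s, i) ∨ σ (s, j.2 + (m : ZMod n)) = nx (σ j) := by
    by_contra hne
    push Not at hne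
    have : 2 < (visC u (!s) p).card :=
      Finset.two_lt_card.2 ⟨_, mem_visC.2 ⟨v4, k4⟩, _, mem_visC.2 ⟨v1, k1⟩, _, mem_visC.2 ⟨v2, k2⟩,
        hne.1, hne.2, fun e => hbr e.symm⟩
    omega
  have hmz : ((m + 1 : ℕ) : ZMod n) = 0 := by
    rcases hcase with e | e
    · have := h.inj e
      simp only [Prod.mk.injEq, true_and, hj, nx] at this
      push_cast
      linear_combination this
    · rw [h5] at e
      simp only [nx, Prod.mk.injEq] at e
      push_cast
      linear_combination -e.2
  apply hbr
  have e1 : (s, j.2 + (m : ZMod n)) = (s, i) := by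
    refine Prod.ext rfl ?_
    simp only [hj, nx]
    push_cast at hmz
    linear_combination hmz
  rw [e1] at h5
  rw [h5]
  refine Prod.ext rfl ?_
  simp only [nx]
  push_cast at hmz
  linear_combination hmz

lemma Mate.reverse (h : Mate u σ) (hx : ∃ x, (σ x).1 ≠ x.1) :
    ∃ c : ZMod n, ∀ i, u (false, i) = u (true, c - i) := by
  have hc := h.all_cross hx
  have hnb := h.no_break hc
  have hσ : ∀ i : ZMod n, σ (true, i) = (false, (σ (true, 0)).2 - i) := by
    have h1 := run_reverse (σ := σ) (j := ((true, 0) : Bool × ZMod n)) (m := n) (by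
      intro k _
      rw [← hnb (true, 0 + (k : ZMod n))]
      simp [nx])
    intro i
    have h2 := h1 i.val (ZMod.val_lt i)
    have h3 : (σ (true, 0)).1 = false := by simpa using hc (true, 0)
    simpa [h3] using h2
  refine ⟨(σ (true, 0)).2 + 1, fun i => ?_⟩
  have h1 := h.m1 (true, (σ (true, 0)).2 - i)
  rw [hσ] at h1
  simp only [nx, sub_sub_cancel] at h1
  rw [h1]
  congr 2
  ring

end cfg

/-! ### Pairs of walks -/

section pairs

variable {n : ℕ} [NeZero n] {α : Type*} [DecidableEq α]

/-- the pair of walks as one function -/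
def pairFun (w w' : ZMod n → α) (x : Bool × ZMod n) : α := if x.1 then w x.2 else w' x.2

lemma pairFun_count (w w' : ZMod n → α) (a b : α) :
    (Finset.univ.filter fun x => pairFun w w' x = a ∧ pairFun w w' (nx x) = b).card
      = stepCount w a b + stepCount w' a b := by
  rw [Finset.card_filter, Fintype.sum_prod_type, Fintype.sum_bool, stepCount, stepCount,
    Finset.card_filter, Finset.card_filter]
  rfl

lemma pairFun_image (w w' : ZMod n → α) :
    Finset.univ.image (pairFun w w') = Finset.univ.image w ∪ Finset.univ.image w' := by
  ext a
  simp [pairFun, or_comm]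

lemma pair_reverse {w w' : ZMod n → α} (hw : NBW w) (hw' : NBW w')
    (hbal : ∀ a b, stepCount w a b + stepCount w' a b = stepCount w b a + stepCount w' b a)
    (hne : ¬ ∀ a b, stepCount w a b = stepCount w b a)
    (hl : n ≤ (Finset.univ.image w ∪ Finset.univ.image w').card + 1) :
    ∃ c, w' = fun i => w (c - i) := by
  have hcfg : Cfg (pairFun w w') := by
    refine ⟨?_, ?_, ?_, ?_⟩
    · rintro ⟨s, i⟩
      cases s
      · exact (hw' i).1
      · exact (hw i).1
    · rintro ⟨s, i⟩
      have e : i + 1 + 1 = i + 2 := by ring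
      cases s
      · have := (hw' i).2
        rw [← e] at this
        exact this
      · have := (hw i).2
        rw [← e] at this
        exact this
    · intro a b
      rw [pairFun_count, pairFun_count, hbal]
    · rw [pairFun_image]; exact hl
  obtain ⟨σ, h⟩ := hcfg.exists_Mate
  have hx : ∃ x, (σ x).1 ≠ x.1 := by
    by_contra hx
    push Not at hx
    apply hne
    have hle : ∀ a b, stepCount w a b ≤ stepCount w b a := by
      intro a b
      unfold stepCount
      refine Finset.card_le_card_of_injOn (fun i => (σ (true, i)).2) ?_ ?_
      · intro i hi
        have hi' : w i = a ∧ w (i + 1) = b := by simpa using hi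
        have e : σ (true, i) = (true, (σ (true, i)).2) := Prod.ext (hx _) rfl
        have m1 := h.m1 (true, i)
        have m2 := h.m2 (true, i)
        rw [e] at m1 m2
        simp only [pairFun, nx, if_true] at m1 m2
        simp [m1, m2, hi'.1, hi'.2]
      · intro i _ i' _ hii
        have e : σ (true, i) = σ (true, i') := Prod.ext ((hx (true, i)).trans (hx (true, i')).symm) hii
        simpa using h.inj e
    exact fun a b => le_antisymm (hle a b) (hle b a)
  obtain ⟨c, hc⟩ := h.reverse hx
  exact ⟨c, funext fun i => by simpa [pairFun] using hc i⟩

/-- a walk with at least `n - 1` vertices has at most one coincidence -/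
lemma collision {w : ZMod n → α} (hl : n ≤ (Finset.univ.image w).card + 1) {i j k l : ZMod n}
    (hij : i ≠ j) (h1 : w i = w j) (hkl : k ≠ l) (h2 : w k = w l) :
    (k = i ∧ l = j) ∨ (k = j ∧ l = i) := by
  have key : ∀ i j : ZMod n, i ≠ j → w i = w j → k = i ∨ l = i := by
    intro i j hij h1
    by_contra hc
    push Not at hc
    have himg : Finset.univ.image w = (Finset.univ.erase i).image w := by
      ext a
      simp only [Finset.mem_image, Finset.mem_univ, true_and, Finset.mem_erase, and_true]
      constructor
      · rintro ⟨x, rfl⟩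
        by_cases hx : x = i
        · exact ⟨j, hij.symm, by rw [hx, h1]⟩
        · exact ⟨x, hx, rfl⟩
      · rintro ⟨x, _, rfl⟩
        exact ⟨x, rfl⟩
    have hcard : (Finset.univ.erase i).card + 1 = n := by
      rw [Finset.card_erase_add_one (Finset.mem_univ i), Finset.card_univ, ZMod.card]
    have hle : ((Finset.univ.erase i).image w).card ≤ (Finset.univ.erase i).card :=
      Finset.card_image_le
    rw [himg] at hl
    have hinj := Finset.card_image_iff.1 (show ((Finset.univ.erase i).image w).card
      = (Finset.univ.erase i).card by omega)
    exact hkl (hinj (by simp [hc.1]) (by simp [hc.2]) h2)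
  rcases key i j hij h1 with e1 | e1 <;> rcases key j i hij.symm h1.symm with e2 | e2
  · exact absurd (e1.symm.trans e2) hij
  · exact Or.inl ⟨e1, e2⟩
  · exact Or.inr ⟨e2, e1⟩
  · exact absurd (e1.symm.trans e2) hij

lemma natCast_ne_zero {n : ℕ} (k : ℕ) (hk : 0 < k) (hkn : k < n) : (k : ZMod n) ≠ 0 := by
  intro h
  rw [ZMod.natCast_eq_zero_iff] at h
  exact absurd (Nat.le_of_dvd hk h) (by omega)

lemma stepCount_reverse (w : ZMod n → α) (c : ZMod n) (a b : α) :
    stepCount (fun i => w (c - i)) a b = stepCount w b a := by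
  unfold stepCount
  refine Finset.card_bij' (fun i _ => c - i - 1) (fun i _ => c - i - 1) ?_ ?_ ?_ ?_
  · intro i hi
    simp only [Finset.mem_filter, Finset.mem_univ, true_and] at hi ⊢
    rw [← hi.1, ← hi.2]
    constructor <;> congr 1 <;> ring
  · intro i hi
    simp only [Finset.mem_filter, Finset.mem_univ, true_and] at hi ⊢
    rw [← hi.1, ← hi.2]
    constructor <;> congr 1 <;> ring
  · intro i _; ring
  · intro i _; ring

lemma NBW_reverse {w : ZMod n → α} (hw : NBW w) (c : ZMod n) : NBW (fun i => w (c - i)) := by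
  intro i
  constructor
  · have := (hw (c - (i + 1))).1.symm
    rw [show c - (i + 1) + 1 = c - i by ring] at this
    exact this
  · have := (hw (c - (i + 2))).2.symm
    rw [show c - (i + 2) + 2 = c - i by ring] at this
    exact this

lemma image_reverse (w : ZMod n → α) (c : ZMod n) :
    Finset.univ.image (fun i => w (c - i)) = Finset.univ.image w := by
  ext a
  simp only [Finset.mem_image, Finset.mem_univ, true_and]
  constructor
  · rintro ⟨i, rfl⟩; exact ⟨_, rfl⟩
  · rintro ⟨i, rfl⟩; exact ⟨c - i, by simp⟩

lemma reverse_inj (hn : 5 ≤ n) {w : ZMod n → α} (hl : n ≤ (Finset.univ.image w).card + 1)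
    {c c' : ZMod n} (h : (fun i => w (c - i)) = fun i => w (c' - i)) : c = c' := by
  by_contra hcc
  have h1 := congrFun h 0
  have h2 := congrFun h 1
  simp only [sub_zero] at h1 h2
  have hz1 : ((1 : ℕ) : ZMod n) ≠ 0 := natCast_ne_zero 1 (by omega) (by omega)
  have hz2 : ((2 : ℕ) : ZMod n) ≠ 0 := natCast_ne_zero 2 (by omega) (by omega)
  push_cast at hz1 hz2
  rcases collision hl hcc h1 (fun e => hcc (by linear_combination e)) h2 with ⟨e1, e2⟩ | ⟨e1, e2⟩
  · apply hz1; linear_combination -e1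
  · apply hz2; linear_combination -e1 - e2

lemma flow_ne (hn : 5 ≤ n) {w : ZMod n → α} (hw : NBW w) (hl : n ≤ (Finset.univ.image w).card + 1) :
    ¬ ∀ a b, stepCount w a b = stepCount w b a := by
  intro h
  have h1 := h (w 0) (w 1)
  have h2 : 0 < stepCount w (w 0) (w 1) := Finset.card_pos.2 ⟨0, by simp⟩
  rw [h1] at h2
  obtain ⟨i, hi⟩ := Finset.card_pos.1 h2
  simp only [Finset.mem_filter, Finset.mem_univ, true_and] at hi
  have hz1 : ((1 : ℕ) : ZMod n) ≠ 0 := natCast_ne_zero 1 (by omega) (by omega)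
  push_cast at hz1
  have i1 : i ≠ 1 := by
    rintro rfl
    apply (hw 0).2
    rw [← hi.2]
    congr 1
    ring
  have i2 : i + 1 ≠ 0 := by
    intro e
    apply (hw i).2
    rw [hi.1]
    congr 1
    linear_combination -e
  have i3 : w 0 ≠ w 1 := by
    have := (hw 0).1
    rwa [zero_add] at this
  rcases collision hl i1 hi.1 i2 hi.2 with ⟨e1, e2⟩ | ⟨e1, e2⟩
  · exact hz1 e2.symm
  · rw [← e2] at hi
    exact i3 hi.1

end pairs

/-! ### Counting -/

lemma card_few_values {ι : Type*} [Fintype ι] [DecidableEq ι] [Nonempty ι] (N k : ℕ) :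
    (Finset.univ.filter fun f : ι → Fin N => (Finset.univ.image f).card ≤ k).card
      ≤ k ^ Fintype.card ι * N ^ k := by
  classical
  have hsub : (Finset.univ.filter fun f : ι → Fin N => (Finset.univ.image f).card ≤ k)
      ⊆ (Finset.univ : Finset ((ι → Fin k) × (Fin k → Fin N))).image (fun gh => gh.2 ∘ gh.1) := by
    intro f hf
    simp only [Finset.mem_filter, Finset.mem_univ, true_and] at hf
    obtain ⟨e⟩ : Nonempty ({x // x ∈ Finset.univ.image f} ↪ Fin k) :=
      Function.Embedding.nonempty_of_card_le (by rw [Fintype.card_coe, Fintype.card_fin]; exact hf)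
    obtain ⟨i0⟩ := ‹Nonempty ι›
    refine Finset.mem_image.2 ⟨(fun i => e ⟨f i, by simp⟩,
      Function.extend e Subtype.val (fun _ => f i0)), Finset.mem_univ _, ?_⟩
    funext i
    simp only [Function.comp_apply]
    rw [e.injective.extend_apply]
  refine (Finset.card_le_card hsub).trans (Finset.card_image_le.trans ?_)
  simp

lemma card_coincide {ι : Type*} [Fintype ι] [DecidableEq ι] (N : ℕ) {i j : ι} (hij : i ≠ j) :
    (Finset.univ.filter fun f : ι → Fin N => f i = f j).card = N ^ (Fintype.card ι - 1) := by
  rw [Finset.card_filter, ← Equiv.sum_comp (Equiv.funSplitAt j (Fin N)).symm, Fintype.sum_prod_type,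
    Finset.sum_comm]
  simp [Equiv.funSplitAt, Equiv.piSplitAt, hij, Finset.card_univ, Fintype.card_subtype_compl]

lemma card_few_pairs {n : ℕ} [NeZero n] (N k : ℕ) :
    (Finset.univ.filter fun f : (ZMod n → Fin N) × (ZMod n → Fin N) =>
      (Finset.univ.image f.1 ∪ Finset.univ.image f.2).card ≤ k).card ≤ k ^ (2 * n) * N ^ k := by
  have h := card_few_values (ι := Bool × ZMod n) N k
  rw [Fintype.card_prod, Fintype.card_bool, ZMod.card] at h
  refine le_trans (Finset.card_le_card_of_injOn (fun f => pairFun f.1 f.2) ?_ ?_) h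
  · intro f hf
    simp only [Finset.coe_filter, Finset.mem_univ, true_and, Set.mem_ofPred_eq] at hf ⊢
    rw [pairFun_image]
    exact hf
  · rintro ⟨f, g⟩ _ ⟨f', g'⟩ _ h
    refine Prod.ext (funext fun i => ?_) (funext fun i => ?_)
    · exact congrFun h (true, i)
    · exact congrFun h (false, i)

/-- the shift associated with a kind of backtracking -/
def shiftOf {n : ℕ} (s : Bool) : ZMod n := if s then 1 else 2

open Classical in
lemma nb_indicator {n : ℕ} [NeZero n] (hn : 5 ≤ n) {α : Type*} [DecidableEq α] (w : ZMod n → α)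
    (hl : n ≤ (Finset.univ.image w).card + 1) :
    (if NBW w then (1 : ℝ) else 0)
      = 1 - ∑ x : Bool × ZMod n, if w x.2 = w (x.2 + shiftOf x.1) then (1 : ℝ) else 0 := by
  have hz1 : ((1 : ℕ) : ZMod n) ≠ 0 := natCast_ne_zero 1 (by omega) (by omega)
  have hz2 : ((2 : ℕ) : ZMod n) ≠ 0 := natCast_ne_zero 2 (by omega) (by omega)
  have hz3 : ((3 : ℕ) : ZMod n) ≠ 0 := natCast_ne_zero 3 (by omega) (by omega)
  have hz4 : ((4 : ℕ) : ZMod n) ≠ 0 := natCast_ne_zero 4 (by omega) (by omega)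
  push_cast at hz1 hz2 hz3 hz4
  have hsh : ∀ s : Bool, (shiftOf s : ZMod n) ≠ 0 := by
    intro s; cases s <;> simp [shiftOf, hz1, hz2]
  split_ifs with h
  · rw [Finset.sum_eq_zero]
    · simp
    · rintro ⟨s, i⟩ _
      rw [if_neg]
      cases s
      · exact (h i).2
      · exact (h i).1
  · have hex : ∃ x : Bool × ZMod n, w x.2 = w (x.2 + shiftOf x.1) := by
      by_contra hc
      push Not at hc
      exact h fun i => ⟨hc (true, i), hc (false, i)⟩
    obtain ⟨x, hx⟩ := hex
    rw [Finset.sum_eq_single x]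
    · simp [hx]
    · rintro y _ hyx
      rw [if_neg]
      intro hy
      have ne : ∀ z : Bool × ZMod n, z.2 ≠ z.2 + shiftOf z.1 := fun z e =>
        hsh z.1 (by linear_combination -e)
      apply hyx
      obtain ⟨s, i⟩ := x
      obtain ⟨t, k⟩ := y
      rcases collision hl (ne _) hx (ne _) hy with ⟨e1, e2⟩ | ⟨e1, e2⟩
      · simp only at e1 e2
        subst e1
        have e3 := add_left_cancel e2
        cases s <;> cases t <;> simp only [shiftOf] at e3 <;> try rfl
        · exact absurd (by simpa using e3 : (1 : ZMod n) = 2) (fun e => hz1 (by linear_combination -e))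
        · exact absurd (by simpa using e3 : (2 : ZMod n) = 1) (fun e => hz1 (by linear_combination e))
      · simp only at e1 e2
        have e3 : (shiftOf s + shiftOf t : ZMod n) = 0 := by linear_combination e2 - e1
        exfalso
        cases s <;> cases t <;> simp only [shiftOf] at e3
        · exact hz4 (by simp at e3; linear_combination e3)
        · exact hz3 (by simp at e3; linear_combination e3)
        · exact hz3 (by simp at e3; linear_combination e3)
        · exact hz2 (by simp at e3; linear_combination e3)
    · simp

open Classical in
lemma card_nb {n : ℕ} [NeZero n] (hn : 5 ≤ n) (N : ℕ) :
    |((Finset.univ.filter fun w : ZMod n → Fin N => NBW w).card : ℝ)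
        - ((N : ℝ) ^ n - 2 * n * (N : ℝ) ^ (n - 1))|
      ≤ (2 * n + 2) * (((n - 2 : ℕ) : ℝ) ^ n * (N : ℝ) ^ (n - 2)) := by
  have h1 : ((Finset.univ.filter fun w : ZMod n → Fin N => NBW w).card : ℝ)
      = ∑ w : ZMod n → Fin N, if NBW w then (1 : ℝ) else 0 := by
    rw [Finset.sum_boole]
  have h2 : (N : ℝ) ^ n - 2 * n * (N : ℝ) ^ (n - 1) = ∑ w : ZMod n → Fin N,
      (1 - ∑ x : Bool × ZMod n, if w x.2 = w (x.2 + shiftOf x.1) then (1 : ℝ) else 0) := by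
    rw [Finset.sum_sub_distrib, Finset.sum_comm]
    have h3 : ∀ x : Bool × ZMod n,
        (∑ w : ZMod n → Fin N, if w x.2 = w (x.2 + shiftOf x.1) then (1 : ℝ) else 0)
          = (N : ℝ) ^ (n - 1) := by
      rintro ⟨s, i⟩
      have hz1 : ((1 : ℕ) : ZMod n) ≠ 0 := natCast_ne_zero 1 (by omega) (by omega)
      have hz2 : ((2 : ℕ) : ZMod n) ≠ 0 := natCast_ne_zero 2 (by omega) (by omega)
      push_cast at hz1 hz2
      have hsh : (shiftOf s : ZMod n) ≠ 0 := by
        cases s <;> simp [shiftOf, hz1, hz2]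
      rw [Finset.sum_boole, card_coincide N (fun e => hsh (by linear_combination -e)), ZMod.card]
      push_cast
      rfl
    simp only [h3]
    simp [ZMod.card]
  rw [h1, h2, ← Finset.sum_sub_distrib]
  refine (Finset.abs_sum_le_sum_abs _ _).trans ?_
  have h4 := card_few_values (ι := ZMod n) N (n - 2)
  rw [ZMod.card] at h4
  have h5 : ((Finset.univ.filter fun f : ZMod n → Fin N => (Finset.univ.image f).card ≤ n - 2).card : ℝ)
      ≤ ((n - 2 : ℕ) : ℝ) ^ n * (N : ℝ) ^ (n - 2) := by exact_mod_cast h4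
  calc _ ≤ ∑ w : ZMod n → Fin N,
        (2 * n + 2 : ℝ) * (if (Finset.univ.image w).card ≤ n - 2 then (1 : ℝ) else 0) := by
        refine Finset.sum_le_sum fun w _ => ?_
        split_ifs with hw hw2 hw2
        · have a0 : (0 : ℝ) ≤ ∑ x : Bool × ZMod n,
              if w x.2 = w (x.2 + shiftOf x.1) then (1 : ℝ) else 0 :=
            Finset.sum_nonneg fun x _ => by split_ifs <;> norm_num
          have a1 : (∑ x : Bool × ZMod n,
              if w x.2 = w (x.2 + shiftOf x.1) then (1 : ℝ) else 0) ≤ 2 * n := by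
            calc _ ≤ ∑ x : Bool × ZMod n, (1 : ℝ) :=
                  Finset.sum_le_sum fun x _ => by split_ifs <;> norm_num
              _ = 2 * n := by simp [ZMod.card]
          rw [abs_le]; constructor <;> linarith
        · have := nb_indicator hn w (by omega)
          rw [if_pos hw] at this
          rw [← this]; simp
        · have a0 : (0 : ℝ) ≤ ∑ x : Bool × ZMod n,
              if w x.2 = w (x.2 + shiftOf x.1) then (1 : ℝ) else 0 :=
            Finset.sum_nonneg fun x _ => by split_ifs <;> norm_num
          have a1 : (∑ x : Bool × ZMod n,
              if w x.2 = w (x.2 + shiftOf x.1) then (1 : ℝ) else 0) ≤ 2 * n := by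
            calc _ ≤ ∑ x : Bool × ZMod n, (1 : ℝ) :=
                  Finset.sum_le_sum fun x _ => by split_ifs <;> norm_num
              _ = 2 * n := by simp [ZMod.card]
          rw [abs_le]; constructor <;> linarith
        · have := nb_indicator hn w (by omega)
          rw [if_neg hw] at this
          rw [← this]; simp
    _ = (2 * n + 2 : ℝ) * ((Finset.univ.filter fun f : ZMod n → Fin N =>
          (Finset.univ.image f).card ≤ n - 2).card : ℝ) := by
        rw [← Finset.mul_sum, Finset.sum_boole]
    _ ≤ _ := by gcongr

/-! ### The variance as a count -/

open Classical in
/-- pairs of walks contributing to the variance -/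
def goodPairs (n N : ℕ) [NeZero n] : Finset ((ZMod n → Fin N) × (ZMod n → Fin N)) :=
  Finset.univ.filter fun p => NBW p.1 ∧ NBW p.2 ∧
    (∀ a b, stepCount p.1 a b + stepCount p.2 a b = stepCount p.1 b a + stepCount p.2 b a) ∧
    ¬ ∀ a b, stepCount p.1 a b = stepCount p.1 b a

open Classical in
lemma integral_trace (n N : ℕ) [NeZero n] :
    ∫ ω, Matrix.trace ((hashimoto N (phases N ω)) ^ n) ∂(phaseMeasure N)
      = ∑ w ∈ Finset.univ.filter (fun w : ZMod n → Fin N => NBW w),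
        if ∀ a b, stepCount w a b = stepCount w b a then 1 else 0 := by
  simp only [trace_hashimoto]
  rw [integral_finsetSum _ fun w _ => integrable_phase N (stepCount w)]
  exact Finset.sum_congr rfl fun w _ => integral_phase N (stepCount w)

open Classical in
lemma integral_trace_sq (n N : ℕ) [NeZero n] :
    ∫ ω, (Matrix.trace ((hashimoto N (phases N ω)) ^ n)) ^ 2 ∂(phaseMeasure N)
      = ∑ w ∈ Finset.univ.filter (fun w : ZMod n → Fin N => NBW w),
        ∑ w' ∈ Finset.univ.filter (fun w : ZMod n → Fin N => NBW w),
        if ∀ a b, stepCount w a b + stepCount w' a b = stepCount w b a + stepCount w' b a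
          then 1 else 0 := by
  have h : ∀ ω, (Matrix.trace ((hashimoto N (phases N ω)) ^ n)) ^ 2
      = ∑ w ∈ Finset.univ.filter (fun w : ZMod n → Fin N => NBW w),
        ∑ w' ∈ Finset.univ.filter (fun w : ZMod n → Fin N => NBW w),
        Complex.exp (Complex.I * ∑ a, ∑ b, ((stepCount w a b + stepCount w' a b : ℕ) : ℂ)
          * ((phases N ω a b : ℝ) : ℂ)) := by
    intro ω
    rw [trace_hashimoto, sq, Finset.sum_mul_sum]
    refine Finset.sum_congr rfl fun w _ => Finset.sum_congr rfl fun w' _ => ?_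
    rw [← Complex.exp_add, ← mul_add, ← Finset.sum_add_distrib]
    simp only [← Finset.sum_add_distrib, Nat.cast_add, add_mul]
  simp only [h]
  have hi : ∀ w w' : ZMod n → Fin N, Integrable (fun ω => Complex.exp (Complex.I *
      ∑ a, ∑ b, ((stepCount w a b + stepCount w' a b : ℕ) : ℂ) * ((phases N ω a b : ℝ) : ℂ)))
      (phaseMeasure N) := fun w w' => integrable_phase N (fun a b => stepCount w a b + stepCount w' a b)
  rw [integral_finsetSum _ fun w _ => integrable_finsetSum _ fun w' _ => hi w w']
  refine Finset.sum_congr rfl fun w _ => ?_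
  rw [integral_finsetSum _ fun w' _ => hi w w']
  refine Finset.sum_congr rfl fun w' _ => ?_
  exact integral_phase N (fun a b => stepCount w a b + stepCount w' a b)

lemma variance_eq (n N : ℕ) [NeZero n] :
    (∫ ω, (Matrix.trace ((hashimoto N (phases N ω)) ^ n)) ^ 2 ∂(phaseMeasure N))
      - (∫ ω, Matrix.trace ((hashimoto N (phases N ω)) ^ n) ∂(phaseMeasure N)) ^ 2
      = ((goodPairs n N).card : ℂ) := by
  classical
  rw [integral_trace, integral_trace_sq, sq, Finset.sum_mul_sum, ← Finset.sum_sub_distrib]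
  simp only [← Finset.sum_sub_distrib]
  rw [← Finset.sum_product', goodPairs, Finset.card_filter]
  push_cast
  rw [← Finset.univ_product_univ, ← Finset.filter_product, Finset.sum_filter]
  refine Finset.sum_congr rfl fun p _ => ?_
  by_cases h1 : NBW p.1
  · by_cases h2 : NBW p.2
    · simp only [h1, h2, true_and, and_self, if_true]
      by_cases h3 : ∀ a b, stepCount p.1 a b = stepCount p.1 b a
      · have h4 : (∀ a b, stepCount p.1 a b + stepCount p.2 a b = stepCount p.1 b a + stepCount p.2 b a)
            ↔ ∀ a b, stepCount p.2 a b = stepCount p.2 b a := by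
          refine forall_congr' fun a => forall_congr' fun b => ?_
          have := h3 a b
          omega
        rw [if_pos h3, one_mul]
        simp only [h4, sub_self]
        rw [if_neg (fun h => h.2 h3)]
      · rw [if_neg h3, zero_mul, sub_zero]
        simp only [h3, not_false_eq_true, and_true]
    · simp [h2]
  · simp [h1]

open Classical in
lemma card_good_large (n N : ℕ) [NeZero n] (hn : 5 ≤ n) :
    ((goodPairs n N).filter fun p =>
      ¬ (Finset.univ.image p.1 ∪ Finset.univ.image p.2).card ≤ n - 2).card
    = n * ((Finset.univ.filter fun w : ZMod n → Fin N => NBW w).filter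
        fun w => ¬ (Finset.univ.image w).card ≤ n - 2).card := by
  have h : (Finset.univ : Finset (ZMod n)).card = n := by rw [Finset.card_univ, ZMod.card]
  have h' : ∀ S : Finset (ZMod n → Fin N), n * S.card = (S ×ˢ (Finset.univ : Finset (ZMod n))).card := by
    intro S
    rw [Finset.card_product, h, mul_comm]
  rw [h']
  symm
  refine Finset.card_bij (fun x _ => (x.1, fun i => x.1 (x.2 - i))) ?_ ?_ ?_
  · rintro ⟨w, c⟩ hw
    simp only [Finset.mem_product, Finset.mem_filter, Finset.mem_univ, true_and, and_true] at hw
    simp only [goodPairs, Finset.mem_filter, Finset.mem_univ, true_and, image_reverse,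
      Finset.union_self, stepCount_reverse]
    refine ⟨⟨hw.1, NBW_reverse hw.1 c, fun a b => add_comm _ _, flow_ne hn hw.1 (by omega)⟩, hw.2⟩
  · rintro ⟨w, c⟩ hw ⟨w', c'⟩ hw' he
    simp only [Finset.mem_product, Finset.mem_filter, Finset.mem_univ, true_and, and_true] at hw
    simp only [Prod.mk.injEq] at he
    obtain ⟨rfl, he⟩ := he
    rw [reverse_inj hn (by omega) he]
  · rintro ⟨w, w'⟩ hp
    simp only [goodPairs, Finset.mem_filter, Finset.mem_univ, true_and] at hp
    obtain ⟨⟨h1, h2, h3, h4⟩, h5⟩ := hp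
    obtain ⟨c, rfl⟩ := pair_reverse h1 h2 h3 h4 (by omega)
    rw [image_reverse, Finset.union_self] at h5
    exact ⟨(w, c), by simp [h1]; omega, rfl⟩

lemma card_good (n N : ℕ) [NeZero n] (hn : 5 ≤ n) :
    |((goodPairs n N).card : ℝ) - (n * (N : ℝ) ^ n - 2 * (n : ℝ) ^ 2 * (N : ℝ) ^ (n - 1))|
      ≤ (((n - 2 : ℕ) : ℝ) ^ (2 * n) + n * ((n - 2 : ℕ) : ℝ) ^ n
        + n * ((2 * n + 2) * ((n - 2 : ℕ) : ℝ) ^ n)) * (N : ℝ) ^ (n - 2) := by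
  classical
  have e1 := Finset.card_filter_add_card_filter_not (s := goodPairs n N)
    (fun p => (Finset.univ.image p.1 ∪ Finset.univ.image p.2).card ≤ n - 2)
  have e2 := Finset.card_filter_add_card_filter_not
    (s := Finset.univ.filter fun w : ZMod n → Fin N => NBW w)
    (fun w => (Finset.univ.image w).card ≤ n - 2)
  rw [card_good_large n N hn] at e1
  have b1 : ((goodPairs n N).filter fun p =>
      (Finset.univ.image p.1 ∪ Finset.univ.image p.2).card ≤ n - 2).card
      ≤ (n - 2) ^ (2 * n) * N ^ (n - 2) :=
    (Finset.card_le_card (Finset.filter_subset_filter _ (Finset.subset_univ _))).trans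
      (card_few_pairs (n := n) N (n - 2))
  have b2 : ((Finset.univ.filter fun w : ZMod n → Fin N => NBW w).filter
      fun w => (Finset.univ.image w).card ≤ n - 2).card ≤ (n - 2) ^ n * N ^ (n - 2) := by
    have := card_few_values (ι := ZMod n) N (n - 2)
    rw [ZMod.card] at this
    exact (Finset.card_le_card (Finset.filter_subset_filter _ (Finset.subset_univ _))).trans this
  have b3 := card_nb hn N
  generalize ((goodPairs n N).filter fun p =>
      (Finset.univ.image p.1 ∪ Finset.univ.image p.2).card ≤ n - 2).card = A at *
  generalize ((Finset.univ.filter fun w : ZMod n → Fin N => NBW w).filter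
      fun w => (Finset.univ.image w).card ≤ n - 2).card = B at *
  generalize ((Finset.univ.filter fun w : ZMod n → Fin N => NBW w).filter
      fun w => ¬ (Finset.univ.image w).card ≤ n - 2).card = C at *
  generalize (Finset.univ.filter fun w : ZMod n → Fin N => NBW w).card = D at *
  generalize (goodPairs n N).card = G at *
  have e1' : (A : ℝ) + n * C = G := by exact_mod_cast e1
  have e2' : (B : ℝ) + C = D := by exact_mod_cast e2
  have b1' : (A : ℝ) ≤ ((n - 2 : ℕ) : ℝ) ^ (2 * n) * (N : ℝ) ^ (n - 2) := by exact_mod_cast b1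
  have b2' : (B : ℝ) ≤ ((n - 2 : ℕ) : ℝ) ^ n * (N : ℝ) ^ (n - 2) := by exact_mod_cast b2
  have hG : (G : ℝ) - (n * (N : ℝ) ^ n - 2 * (n : ℝ) ^ 2 * (N : ℝ) ^ (n - 1))
      = A - n * B + n * (D - ((N : ℝ) ^ n - 2 * n * (N : ℝ) ^ (n - 1))) := by
    rw [← e1', ← e2']; ring
  rw [hG]
  have n0 : (0 : ℝ) ≤ n := Nat.cast_nonneg n
  have A0 : (0 : ℝ) ≤ A := Nat.cast_nonneg A
  have B0 : (0 : ℝ) ≤ B := Nat.cast_nonneg B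
  have t1 : |(A : ℝ) - n * B| ≤ A + n * B := by
    have := mul_nonneg n0 B0
    rw [abs_le]; constructor <;> linarith
  have t2 := abs_add_le ((A : ℝ) - n * B) (n * (D - ((N : ℝ) ^ n - 2 * n * (N : ℝ) ^ (n - 1))))
  rw [abs_mul, abs_of_nonneg n0] at t2
  have t3 := mul_le_mul_of_nonneg_left b3 n0
  have t4 := mul_le_mul_of_nonneg_left b2' n0
  linarith

/-- for fixed `n ≥ 5`, as `N → ∞`, the variance of `Tr[Y(Φ)^n]` satisfies
`Var(Tr[Y(Φ)^n]) = n·N^n − 2n²·N^{n−1} + O(N^{n−2})`, where `Var(X) = ⟨X²⟩ − ⟨X⟩²`. -/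
theorem hashimoto_trace_variance_asymptotics (n : ℕ) (hn : 5 ≤ n) :
    ∃ (c : ℝ) (N₀ : ℕ), ∀ N ≥ N₀,
      ‖((∫ ω, (Matrix.trace ((hashimoto N (phases N ω)) ^ n)) ^ 2 ∂(phaseMeasure N))
            - (∫ ω, Matrix.trace ((hashimoto N (phases N ω)) ^ n) ∂(phaseMeasure N)) ^ 2)
          - ((n : ℂ) * (N : ℂ) ^ n - 2 * (n : ℂ) ^ 2 * (N : ℂ) ^ (n - 1))‖
        ≤ c * (N : ℝ) ^ (n - 2) := by
  have : NeZero n := ⟨by omega⟩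
  refine ⟨((n - 2 : ℕ) : ℝ) ^ (2 * n) + n * ((n - 2 : ℕ) : ℝ) ^ n
        + n * ((2 * n + 2) * ((n - 2 : ℕ) : ℝ) ^ n), 0, fun N _ => ?_⟩
  · rw [variance_eq]
    have h := card_good n N hn
    have e : ((goodPairs n N).card : ℂ) - ((n : ℂ) * (N : ℂ) ^ n - 2 * (n : ℂ) ^ 2 * (N : ℂ) ^ (n - 1))
        = ((((goodPairs n N).card : ℝ)
          - (n * (N : ℝ) ^ n - 2 * (n : ℝ) ^ 2 * (N : ℝ) ^ (n - 1)) : ℝ) : ℂ) := by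
      push_cast; ring
    rw [e, Complex.norm_real, Real.norm_eq_abs]
    exact h
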